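/- Let M_p be a weight sequence satisfying (M.1), (M.2)' and (M.3)', and let f ∈ K'^{(M_p)}(ℝ^d). Then for every q ∈ ℕ there exist continuous functions f_α : ℝ^d → ℂ (α ∈ ℕ^d) and some ℓ > 0, C > 0 such that |f_α(x)| ≤ C (ℓ^{|α|}/M_α) (1+|x|)^{|α|−q} for all x ∈ ℝ^d and α ∈ ℕ^d, and ⟨f,φ⟩ = Σ_{α∈ℕ^d} (−1)^{|α|} ∫ f_α(x) ∂^αφ(x) dx (absolutely convergent) for every φ ∈ D^{(M_p)}(ℝ^d). -/

import Mathlib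

open MeasureTheory Real
open scoped BigOperators Pointwise

noncomputable section

/-- `ℝ^d` with the Euclidean norm. -/
abbrev Rd (d : ℕ) := EuclideanSpace ℝ (Fin d)

/-- Condition (M.1): a positive, logarithmically convex weight sequence. -/
def IsM1 (M : ℕ → ℝ) : Prop :=
  (∀ p, 0 < M p) ∧ ∀ p : ℕ, 1 ≤ p → (M p) ^ 2 ≤ M (p - 1) * M (p + 1)

/-- Condition (M.2)'. -/
def IsM2' (M : ℕ → ℝ) : Prop :=
  ∃ A H : ℝ, 1 ≤ A ∧ 1 ≤ H ∧ ∀ p : ℕ, M (p + 1) ≤ A * H ^ p * M p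

/-- Condition (M.2). -/
def IsM2 (M : ℕ → ℝ) : Prop :=
  ∃ A H : ℝ, 1 ≤ A ∧ 1 ≤ H ∧ ∀ p q : ℕ, M (p + q) ≤ A * H ^ (p + q) * M p * M q

/-- Condition (M.3)'. -/
def IsM3' (M : ℕ → ℝ) : Prop := Summable fun p : ℕ => M p / M (p + 1)

/-- Condition (M.3). -/
def IsM3 (M : ℕ → ℝ) : Prop :=
  IsM3' M ∧ ∃ c₀ > (0 : ℝ), ∀ q : ℕ, 1 ≤ q →
    (∑' j : ℕ, M (q + j - 1) / M (q + j)) ≤ c₀ * q * (M (q - 1) / M q)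

/-- The associated function `M(t) = sup_p log (t^p M 0 / M p)`, with `M(0) = 0`. -/
def assocFn (M : ℕ → ℝ) (t : ℝ) : ℝ :=
  if t = 0 then 0 else ⨆ p : ℕ, Real.log (t ^ p * M 0 / M p)

variable {d : ℕ}

/-- The partial derivative in the `i`-th coordinate direction. -/
def pder (i : Fin d) (f : Rd d → ℂ) : Rd d → ℂ :=
  fun x => fderiv ℝ f x (EuclideanSpace.single i 1)

/-- The multi-index partial derivative `∂^α`. -/
def mderiv (α : Fin d → ℕ) (f : Rd d → ℂ) : Rd d → ℂ :=
  (List.finRange d).foldr (fun i g => (pder i)^[α i] g) f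

/-- The order `|α|` of a multi-index. -/
def mOrd (α : Fin d → ℕ) : ℕ := ∑ i, α i

/-- The factorial `α!` of a multi-index. -/
def mFact (α : Fin d → ℕ) : ℕ := ∏ i, Nat.factorial (α i)

/-- The set of quotients defining the norm of `E^{M_p,ℓ}(K)`. -/
def ESet (M : ℕ → ℝ) (ℓ : ℝ) (K : Set (Rd d)) (φ : Rd d → ℂ) : Set ℝ :=
  {r | ∃ (α : Fin d → ℕ) (x : Rd d), x ∈ K ∧
    r = ‖mderiv α φ x‖ / (ℓ ^ mOrd α * M (mOrd α))}

/-- `‖φ‖_{E^{M_p,ℓ}(K)}`. -/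
def Enorm (M : ℕ → ℝ) (ℓ : ℝ) (K : Set (Rd d)) (φ : Rd d → ℂ) : ℝ :=
  sSup (ESet M ℓ K φ)

/-- Finiteness of `‖φ‖_{E^{M_p,ℓ}(K)}`. -/
def EnormFin (M : ℕ → ℝ) (ℓ : ℝ) (K : Set (Rd d)) (φ : Rd d → ℂ) : Prop :=
  BddAbove (ESet M ℓ K φ)

/-- Membership in the test space `D^{(M_p)}(ℝ^d)`. -/
def IsTestD (M : ℕ → ℝ) (φ : Rd d → ℂ) : Prop :=
  ContDiff ℝ (⊤ : ℕ∞) φ ∧ HasCompactSupport φ ∧ ∀ ℓ > (0 : ℝ), EnormFin M ℓ (tsupport φ) φ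

/-- `f` is a Beurling ultradistribution of class `(M_p)`. -/
def IsUltraD (M : ℕ → ℝ) (f : (Rd d → ℂ) →ₗ[ℂ] ℂ) : Prop :=
  ∀ K : Set (Rd d), IsCompact K → ∃ ℓ > (0 : ℝ), ∃ C > (0 : ℝ), ∀ φ : Rd d → ℂ,
    IsTestD M φ → tsupport φ ⊆ K → ‖f φ‖ ≤ C * Enorm M ℓ K φ

/-- Euclidean dot product. -/
def dotR (ξ t : Rd d) : ℝ := ∑ i, ξ i * t i

/-- The window `t ↦ conj(ψ(t-x)) e^{-2πi ξ·t}` of the short-time Fourier transform. -/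
def windowFn (ψ : Rd d → ℂ) (x ξ : Rd d) : Rd d → ℂ :=
  fun t => (starRingEnd ℂ) (ψ (t - x)) * Complex.exp (-(2 * Real.pi * dotR ξ t : ℝ) * Complex.I)

/-- The short-time Fourier transform of a function `φ` with respect to the window `ψ`. -/
def STFTf (ψ φ : Rd d → ℂ) (x ξ : Rd d) : ℂ := ∫ t, φ t * windowFn ψ x ξ t

/-- The short-time Fourier transform of a linear functional `f` w.r.t. the window `ψ`. -/
def STFTd (f : (Rd d → ℂ) →ₗ[ℂ] ℂ) (ψ : Rd d → ℂ) (x ξ : Rd d) : ℂ := f (windowFn ψ x ξ)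

/-- The weight condition (5): `ω(·+x)/ω(x)` locally uniformly bounded. -/
def OmegaCond (ω : Rd d → ℝ) : Prop :=
  (∀ x, 0 < ω x) ∧ Measurable ω ∧
    ∀ R > (0 : ℝ), ∃ C > (0 : ℝ), ∀ x h : Rd d, ‖h‖ ≤ R → ω (x + h) ≤ C * ω x

/-- The set of values defining the norm `‖φ‖_{K^{M_p,ℓ}_q}`. -/
def KSet (M : ℕ → ℝ) {d : ℕ} (q : ℕ) (ℓ : ℝ) (φ : Rd d → ℂ) : Set ℝ :=
  {r | ∃ (α : Fin d → ℕ) (x : Rd d),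
    r = (1 + ‖x‖) ^ ((mOrd α : ℤ) - q) * ‖mderiv α φ x‖ / (ℓ ^ mOrd α * M (mOrd α))}

/-- `‖φ‖_{K^{M_p,ℓ}_q}`. -/
def Knorm (M : ℕ → ℝ) {d : ℕ} (q : ℕ) (ℓ : ℝ) (φ : Rd d → ℂ) : ℝ := sSup (KSet M q ℓ φ)

/-- Finiteness of `‖φ‖_{K^{M_p,ℓ}_q}`. -/
def KnormFin (M : ℕ → ℝ) {d : ℕ} (q : ℕ) (ℓ : ℝ) (φ : Rd d → ℂ) : Prop :=
  BddAbove (KSet M q ℓ φ)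

/-- Membership in `K^{(M_p)}(ℝ^d)`. -/
def IsKTest (M : ℕ → ℝ) {d : ℕ} (φ : Rd d → ℂ) : Prop :=
  ContDiff ℝ (⊤ : ℕ∞) φ ∧ ∃ q : ℕ, ∀ ℓ > (0 : ℝ), KnormFin M q ℓ φ

/-- Membership in the dual space `K'^{(M_p)}(ℝ^d)`. -/
def IsKDual (M : ℕ → ℝ) {d : ℕ} (f : (Rd d → ℂ) →ₗ[ℂ] ℂ) : Prop :=
  ∀ q : ℕ, ∃ ℓ > (0 : ℝ), ∃ C > (0 : ℝ), ∀ φ : Rd d → ℂ, ContDiff ℝ (⊤ : ℕ∞) φ →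
    (∀ ℓ' > (0 : ℝ), KnormFin M q ℓ' φ) → ‖f φ‖ ≤ C * Knorm M q ℓ φ

/-- The finite set of multi-indices of order `< k`. -/
def momIdx (d k : ℕ) : Finset (Fin d → ℕ) :=
  (Fintype.piFinset fun _ : Fin d => Finset.range k).filter fun α => mOrd α < k

/-- The monomial `x ↦ x^α`. -/
def monomial {d : ℕ} (α : Fin d → ℕ) : Rd d → ℂ := fun x => ∏ i, (x i : ℂ) ^ α i

section Multiindex

theorem contDiff_pder {i : Fin d} {f : Rd d → ℂ} (hf : ContDiff ℝ (⊤ : ℕ∞) f) :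
    ContDiff ℝ (⊤ : ℕ∞) (pder i f) :=
  (hf.fderiv_right (m := (⊤ : ℕ∞)) (by simp)).clm_apply contDiff_const

theorem contDiff_pder_iterate {i : Fin d} {f : Rd d → ℂ} (hf : ContDiff ℝ (⊤ : ℕ∞) f) (n : ℕ) :
    ContDiff ℝ (⊤ : ℕ∞) ((pder i)^[n] f) := by
  induction n with
  | zero => exact hf
  | succ n ih => rw [Function.iterate_succ_apply']; exact contDiff_pder ih

theorem contDiff_foldr_pder (l : List (Fin d)) (α : Fin d → ℕ) {f : Rd d → ℂ}
    (hf : ContDiff ℝ (⊤ : ℕ∞) f) :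
    ContDiff ℝ (⊤ : ℕ∞) (l.foldr (fun i g => (pder i)^[α i] g) f) := by
  induction l with
  | nil => exact hf
  | cons i l ih => exact contDiff_pder_iterate ih _

theorem contDiff_mderiv (α : Fin d → ℕ) {f : Rd d → ℂ} (hf : ContDiff ℝ (⊤ : ℕ∞) f) :
    ContDiff ℝ (⊤ : ℕ∞) (mderiv α f) :=
  contDiff_foldr_pder _ α hf

theorem pder_comm (i j : Fin d) {f : Rd d → ℂ} (hf : ContDiff ℝ (⊤ : ℕ∞) f) :
    pder i (pder j f) = pder j (pder i f) := by
  have hdf : Differentiable ℝ (fderiv ℝ f) :=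
    (hf.fderiv_right (m := (⊤ : ℕ∞)) (by simp)).differentiable (by simp)
  have key : ∀ (i j : Fin d) (x : Rd d), pder i (pder j f) x =
      fderiv ℝ (fderiv ℝ f) x (EuclideanSpace.single i 1) (EuclideanSpace.single j 1) := by
    intro i j x
    have h := ((hdf x).hasFDerivAt.clm_apply
      (hasFDerivAt_const (EuclideanSpace.single j (1 : ℝ)) x)).fderiv
    change fderiv ℝ (fun y => fderiv ℝ f y (EuclideanSpace.single j 1)) x _ = _
    rw [h]
    simp
  ext x
  rw [key, key]
  refine (hf.contDiffAt.isSymmSndFDerivAt ?_) _ _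
  rw [minSmoothness_of_isRCLikeNormedField]
  exact WithTop.coe_le_coe.2 le_top

theorem pder_iterate_comm (i j : Fin d) {f : Rd d → ℂ} (hf : ContDiff ℝ (⊤ : ℕ∞) f) (n : ℕ) :
    pder i ((pder j)^[n] f) = (pder j)^[n] (pder i f) := by
  induction n with
  | zero => rfl
  | succ n ih =>
    rw [Function.iterate_succ_apply', Function.iterate_succ_apply',
      pder_comm i j (contDiff_pder_iterate hf n), ih]

theorem pder_foldr_pder (l : List (Fin d)) (hl : l.Nodup) (i : Fin d) (hi : i ∈ l)
    (α : Fin d → ℕ) {f : Rd d → ℂ} (hf : ContDiff ℝ (⊤ : ℕ∞) f) :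
    pder i (l.foldr (fun j g => (pder j)^[α j] g) f) =
      l.foldr (fun j g => (pder j)^[(α + Pi.single i 1 : Fin d → ℕ) j] g) f := by
  induction l with
  | nil => simp at hi
  | cons j l ih =>
    rw [List.nodup_cons] at hl
    simp only [List.foldr_cons]
    by_cases hij : i = j
    · subst hij
      have h : l.foldr (fun j g => (pder j)^[(α + Pi.single i 1 : Fin d → ℕ) j] g) f =
          l.foldr (fun j g => (pder j)^[α j] g) f := by
        apply List.foldr_ext
        intro j hj g
        have : j ≠ i := fun h => hl.1 (h ▸ hj)
        simp [this]
      rw [h, ← Function.iterate_succ_apply' (pder i)]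
      simp
    · have hil : i ∈ l := by simpa [hij] using hi
      rw [pder_iterate_comm i j (contDiff_foldr_pder l α hf), ih hl.2 hil]
      simp [Ne.symm hij]

theorem pder_mderiv (i : Fin d) (α : Fin d → ℕ) {f : Rd d → ℂ} (hf : ContDiff ℝ (⊤ : ℕ∞) f) :
    pder i (mderiv α f) = mderiv (α + Pi.single i 1) f :=
  pder_foldr_pder _ (List.nodup_finRange d) i (List.mem_finRange i) α hf

theorem pder_add (i : Fin d) {f g : Rd d → ℂ} (hf : ContDiff ℝ (⊤ : ℕ∞) f)
    (hg : ContDiff ℝ (⊤ : ℕ∞) g) : pder i (f + g) = pder i f + pder i g := by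
  ext x
  simp only [pder, Pi.add_apply]
  rw [fderiv_add (hf.differentiable (by simp) x) (hg.differentiable (by simp) x)]
  rfl

theorem pder_smul (i : Fin d) (c : ℂ) {f : Rd d → ℂ} (hf : ContDiff ℝ (⊤ : ℕ∞) f) :
    pder i (c • f) = c • pder i f := by
  ext x
  simp only [pder, Pi.smul_apply]
  rw [fderiv_const_smul (hf.differentiable (by simp) x)]
  rfl

theorem mderiv_add (α : Fin d → ℕ) {f g : Rd d → ℂ} (hf : ContDiff ℝ (⊤ : ℕ∞) f)
    (hg : ContDiff ℝ (⊤ : ℕ∞) g) : mderiv α (f + g) = mderiv α f + mderiv α g := by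
  have hit : ∀ (i : Fin d) (n : ℕ) (f g : Rd d → ℂ), ContDiff ℝ (⊤ : ℕ∞) f →
      ContDiff ℝ (⊤ : ℕ∞) g → (pder i)^[n] (f + g) = (pder i)^[n] f + (pder i)^[n] g := by
    intro i n
    induction n with
    | zero => intros; rfl
    | succ n ih =>
      intro f g hf hg
      simp only [Function.iterate_succ_apply]
      rw [pder_add i hf hg, ih _ _ (contDiff_pder hf) (contDiff_pder hg)]
  unfold mderiv
  induction List.finRange d with
  | nil => rfl
  | cons i l ih =>
    simp only [List.foldr_cons]
    rw [ih, hit i _ _ _ (contDiff_foldr_pder l α hf) (contDiff_foldr_pder l α hg)]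

theorem mderiv_smul (α : Fin d → ℕ) (c : ℂ) {f : Rd d → ℂ} (hf : ContDiff ℝ (⊤ : ℕ∞) f) :
    mderiv α (c • f) = c • mderiv α f := by
  have hit : ∀ (i : Fin d) (n : ℕ) (f : Rd d → ℂ), ContDiff ℝ (⊤ : ℕ∞) f →
      (pder i)^[n] (c • f) = c • (pder i)^[n] f := by
    intro i n
    induction n with
    | zero => intros; rfl
    | succ n ih =>
      intro f hf
      simp only [Function.iterate_succ_apply]
      rw [pder_smul i c hf, ih _ (contDiff_pder hf)]
  unfold mderiv
  induction List.finRange d with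
  | nil => rfl
  | cons i l ih =>
    simp only [List.foldr_cons]
    rw [ih, hit i _ _ (contDiff_foldr_pder l α hf)]

theorem tsupport_mderiv_subset (α : Fin d → ℕ) (f : Rd d → ℂ) :
    tsupport (mderiv α f) ⊆ tsupport f := by
  have hp : ∀ (i : Fin d) (g : Rd d → ℂ), tsupport (pder i g) ⊆ tsupport g := by
    intro i g
    refine closure_minimal (fun x hx => ?_) (isClosed_tsupport g)
    refine support_fderiv_subset ℝ (f := g) ?_
    intro h
    apply hx
    simp [pder, h]
  have hit : ∀ (i : Fin d) (n : ℕ) (g : Rd d → ℂ), tsupport ((pder i)^[n] g) ⊆ tsupport g := by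
    intro i n
    induction n with
    | zero => intro g; exact subset_rfl
    | succ n ih =>
      intro g
      rw [Function.iterate_succ_apply]
      exact (ih _).trans (hp i g)
  unfold mderiv
  induction List.finRange d with
  | nil => exact subset_rfl
  | cons i l ih => exact (hit i _ _).trans ih

theorem mOrd_add (α β : Fin d → ℕ) : mOrd (α + β) = mOrd α + mOrd β := by
  simp [mOrd, Finset.sum_add_distrib]

theorem summable_pow_mOrd {r : ℝ} (h0 : 0 ≤ r) (h1 : r < 1) :
    ∀ d : ℕ, Summable fun α : Fin d → ℕ => r ^ mOrd α := by
  intro d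
  induction d with
  | zero => exact (hasSum_fintype _).summable
  | succ d ih =>
    rw [← (Fin.consEquiv fun _ : Fin (d + 1) => ℕ).summable_iff]
    refine ((summable_geometric_of_lt_one h0 h1).mul_of_nonneg ih
      (fun n => pow_nonneg h0 _) (fun α => pow_nonneg h0 _)).congr ?_
    rintro ⟨n, α⟩
    simp [mOrd, Fin.sum_univ_succ, pow_add, Fin.consEquiv]

end Multiindex

section Sobolev

theorem enorm_sq_le_lintegral {h h' : ℝ → ℂ} (hd : ∀ t, HasDerivAt h (h' t) t)
    (hc : Continuous h') {a y : ℝ} (hy : y ∈ Set.Icc a (a + 1)) :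
    ‖h y‖ₑ ^ 2 ≤ 2 * ∫⁻ t in Set.Icc a (a + 1), (‖h t‖ₑ ^ 2 + ‖h' t‖ₑ ^ 2) := by
  have hch : Continuous h := continuous_iff_continuousAt.2 fun t => (hd t).continuousAt
  set I := ∫ t in Set.Icc a (a + 1), (‖h t‖ ^ 2 + ‖h' t‖ ^ 2) with hI
  have hcont : Continuous fun t => ‖h t‖ ^ 2 + ‖h' t‖ ^ 2 := by fun_prop
  have hint : IntegrableOn (fun t => ‖h t‖ ^ 2 + ‖h' t‖ ^ 2) (Set.Icc a (a + 1)) :=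
    hcont.integrableOn_Icc
  have hN : ∀ t, HasDerivAt (fun t => ‖h t‖ ^ 2) (2 * inner ℝ (h t) (h' t)) t :=
    fun t => (hd t).norm_sq
  have hcN : Continuous fun t => 2 * inner ℝ (h t) (h' t) := by fun_prop
  have hle : ∀ t ∈ Set.Icc a (a + 1), ‖h y‖ ^ 2 ≤ ‖h t‖ ^ 2 + I := by
    intro t ht
    have e := intervalIntegral.integral_eq_sub_of_hasDerivAt (a := t) (b := y)
      (fun s _ => hN s) (hcN.intervalIntegrable _ _)
    have e2 : ‖∫ s in t..y, 2 * inner ℝ (h s) (h' s)‖ ≤ I := by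
      refine (intervalIntegral.norm_integral_le_integral_norm_uIoc).trans ?_
      have hsub : Set.uIoc t y ⊆ Set.Icc a (a + 1) :=
        Set.uIoc_subset_uIcc.trans (Set.uIcc_subset_Icc ht hy)
      refine (setIntegral_mono_on (g := fun t => ‖h t‖ ^ 2 + ‖h' t‖ ^ 2)
        (hcN.norm.integrableOn_uIoc) (hint.mono_set hsub) measurableSet_uIoc ?_).trans ?_
      · intro s _
        have := norm_inner_le_norm (𝕜 := ℝ) (h s) (h' s)
        rw [norm_mul]
        simp only [Real.norm_ofNat]
        nlinarith [sq_nonneg (‖h s‖ - ‖h' s‖)]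
      · exact setIntegral_mono_set hint (ae_of_all _ fun s => by positivity)
          hsub.eventuallyLE
    have := (le_abs_self _).trans e2
    linarith
  have hfin : ‖h y‖ ^ 2 ≤ 2 * I := by
    have h1 : ∫ t in Set.Icc a (a + 1), ‖h y‖ ^ 2 ≤
        ∫ t in Set.Icc a (a + 1), (‖h t‖ ^ 2 + ‖h' t‖ ^ 2 + I) := by
      refine setIntegral_mono_on (by simp) ?_ measurableSet_Icc ?_
      · exact hint.add (by simp)
      · intro t ht
        have := hle t ht
        have := sq_nonneg ‖h' t‖
        linarith
    rw [integral_add hint (by simp)] at h1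
    simp only [setIntegral_const, Real.volume_real_Icc, smul_eq_mul, ← hI] at h1
    norm_num at h1
    linarith
  have hl : ∫⁻ t in Set.Icc a (a + 1), (‖h t‖ₑ ^ 2 + ‖h' t‖ₑ ^ 2) = ENNReal.ofReal I := by
    rw [hI, ofReal_integral_eq_lintegral_ofReal hint (ae_of_all _ fun s => by positivity)]
    refine lintegral_congr fun t => ?_
    rw [ENNReal.ofReal_add (by positivity) (by positivity), ENNReal.ofReal_pow (norm_nonneg _),
      ENNReal.ofReal_pow (norm_nonneg _), ofReal_norm, ofReal_norm]
  rw [hl, ← ofReal_norm, ← ENNReal.ofReal_pow (norm_nonneg _),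
    show (2 : ENNReal) = ENNReal.ofReal 2 by simp, ← ENNReal.ofReal_mul (by norm_num)]
  exact ENNReal.ofReal_le_ofReal hfin

/-- The multi-index that is `1` on `t` and `0` elsewhere. -/
def indIdx (t : Finset (Fin d)) : Fin d → ℕ := fun i => if i ∈ t then 1 else 0

theorem indIdx_insert {t : Finset (Fin d)} {i : Fin d} (hi : i ∉ t) :
    indIdx (insert i t) = Pi.single i 1 + indIdx t := by
  ext j
  by_cases h : j = i
  · subst h; simp [indIdx, hi]
  · simp [indIdx, h]

theorem mOrd_indIdx_le (t : Finset (Fin d)) : mOrd (indIdx t) ≤ d := by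
  have : mOrd (indIdx t) = t.card := by simp [mOrd, indIdx]
  rw [this]
  simpa using Finset.card_le_univ t

theorem enorm_sq_mderiv_le_lmarginal {φ : Rd d → ℂ} (hφ : ContDiff ℝ (⊤ : ℕ∞) φ)
    (x : Rd d) (s : Finset (Fin d)) :
    ∀ (α : Fin d → ℕ) (y : Fin d → ℝ), (∀ i, y i ∈ Set.Icc (x i) (x i + 1)) →
      ‖mderiv α φ (WithLp.toLp 2 y)‖ₑ ^ 2 ≤ 2 ^ s.card *
        (lmarginal (fun i => volume.restrict (Set.Icc (x i) (x i + 1))) s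
          fun z => ∑ t ∈ s.powerset, ‖mderiv (α + indIdx t) φ (WithLp.toLp 2 z)‖ₑ ^ 2) y := by
  have hmeas : ∀ α : Fin d → ℕ, Measurable fun z : Fin d → ℝ =>
      ‖mderiv α φ (WithLp.toLp 2 z)‖ₑ ^ 2 := by
    intro α
    have : Continuous fun z : Fin d → ℝ => mderiv α φ (WithLp.toLp 2 z) :=
      (contDiff_mderiv α hφ).continuous.comp (PiLp.continuous_toLp 2 _)
    exact (this.measurable.enorm.pow_const 2)
  have hmeas' : ∀ (s : Finset (Fin d)) (α : Fin d → ℕ), Measurable fun z : Fin d → ℝ =>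
      ∑ t ∈ s.powerset, ‖mderiv (α + indIdx t) φ (WithLp.toLp 2 z)‖ₑ ^ 2 :=
    fun s α => Finset.measurable_sum _ fun t _ => hmeas _
  induction s using Finset.induction_on with
  | empty =>
    intro α y _
    have h0 : indIdx (∅ : Finset (Fin d)) = 0 := by ext; simp [indIdx]
    simp [h0]
  | insert i s hi ih =>
    intro α y hy
    rw [lmarginal_insert _ (hmeas' _ _) hi]
    have hder : ∀ t, HasDerivAt
        (fun t => mderiv α φ (WithLp.toLp 2 (Function.update y i t)))
        (mderiv (α + Pi.single i 1) φ (WithLp.toLp 2 (Function.update y i t))) t := by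
      intro t
      have hu : HasDerivAt (fun t => (WithLp.toLp 2 (Function.update y i t) : Rd d))
          (EuclideanSpace.single i (1 : ℝ)) t := by
        have hp : HasDerivAt (fun t => Function.update y i t) (Pi.single i (1 : ℝ)) t := by
          rw [hasDerivAt_pi]
          intro j
          by_cases hj : j = i
          · subst hj; simpa using hasDerivAt_id' t
          · simpa [hj] using hasDerivAt_const t (y j)
        exact (PiLp.hasFDerivAt_toLp (𝕜 := ℝ) 2 (Function.update y i t)).comp_hasDerivAt t hp
      have := (((contDiff_mderiv α hφ).differentiable (by simp)
        (WithLp.toLp 2 (Function.update y i t))).hasFDerivAt).comp_hasDerivAt t hu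
      rw [← pder_mderiv i α hφ]
      exact this
    have hcont : Continuous fun t =>
        mderiv (α + Pi.single i 1) φ (WithLp.toLp 2 (Function.update y i t)) :=
      (contDiff_mderiv _ hφ).continuous.comp
        ((PiLp.continuous_toLp 2 _).comp (continuous_const.update i continuous_id))
    have h1 := enorm_sq_le_lintegral hder hcont (hy i)
    simp only [Function.update_eq_self] at h1
    refine h1.trans ?_
    rw [Finset.card_insert_of_notMem hi, pow_succ', mul_assoc]
    gcongr
    rw [← lintegral_const_mul' _ _ (by simp)]
    refine setLIntegral_mono' measurableSet_Icc fun t ht => ?_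
    have hy' : ∀ j, Function.update y i t j ∈ Set.Icc (x j) (x j + 1) := by
      intro j
      by_cases hj : j = i
      · subst hj; simpa using ht
      · simpa [hj] using hy j
    refine (add_le_add (ih α _ hy') (ih (α + Pi.single i 1) _ hy')).trans ?_
    rw [← mul_add]
    gcongr
    have hsum : (fun z : Fin d → ℝ => ∑ t ∈ (insert i s).powerset,
          ‖mderiv (α + indIdx t) φ (WithLp.toLp 2 z)‖ₑ ^ 2) =
        (fun z => ∑ t ∈ s.powerset, ‖mderiv (α + indIdx t) φ (WithLp.toLp 2 z)‖ₑ ^ 2) +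
        fun z => ∑ t ∈ s.powerset,
          ‖mderiv (α + Pi.single i 1 + indIdx t) φ (WithLp.toLp 2 z)‖ₑ ^ 2 := by
      ext z
      rw [Finset.sum_powerset_insert hi, Pi.add_apply]
      congr 1
      refine Finset.sum_congr rfl fun t ht => ?_
      rw [indIdx_insert fun h => hi (Finset.mem_powerset.1 ht h), add_assoc]
    rw [hsum]
    unfold lmarginal
    simp only [Pi.add_apply]
    rw [lintegral_add_left]
    exact (hmeas' s α).comp measurable_updateFinset

theorem enorm_sq_mderiv_le_lintegral {φ : Rd d → ℂ} (hφ : ContDiff ℝ (⊤ : ℕ∞) φ)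
    (x : Rd d) (α : Fin d → ℕ) :
    ‖mderiv α φ x‖ₑ ^ 2 ≤ 2 ^ d * ∑ t : Finset (Fin d),
      ∫⁻ y in {y : Rd d | ∀ i, y i ∈ Set.Icc (x i) (x i + 1)},
        ‖mderiv (α + indIdx t) φ y‖ₑ ^ 2 := by
  have h := enorm_sq_mderiv_le_lmarginal hφ x Finset.univ α x.ofLp (fun i => by simp)
  have hvp := PiLp.volume_preserving_toLp (ι := Fin d)
  have hset : (WithLp.toLp 2 ⁻¹' {y : Rd d | ∀ i, y i ∈ Set.Icc (x i) (x i + 1)} :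
      Set (Fin d → ℝ)) = Set.univ.pi fun i => Set.Icc (x i) (x i + 1) := by
    ext; simp only [Set.mem_preimage, Set.mem_ofPred_eq, Set.mem_univ_pi]
  rw [lmarginal_univ, ← Measure.restrict_pi_pi] at h
  simp only [Finset.powerset_univ, Finset.card_univ, Fintype.card_fin, WithLp.toLp_ofLp] at h
  refine h.trans_eq ?_
  rw [← lintegral_finsetSum, ← volume_pi, ← hset]
  · rw [← hvp.setLIntegral_comp_preimage_emb (MeasurableEquiv.toLp 2 _).measurableEmbedding]
  · intro t _
    exact (contDiff_mderiv _ hφ).continuous.measurable.enorm.pow_const 2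

end Sobolev

section Hilbert

variable {V E : Type*} [AddCommGroup V] [Module ℂ V] [NormedAddCommGroup E]
  [InnerProductSpace ℂ E]

theorem exists_tendsto_inner_eq [CompleteSpace E] (J : V →ₗ[ℂ] E) (f : V →ₗ[ℂ] ℂ) {C : ℝ}
    (hf : ∀ v, ‖f v‖ ≤ C * ‖J v‖) :
    ∃ (g : E) (v : ℕ → V), Filter.Tendsto (fun n => J (v n)) Filter.atTop (nhds g) ∧
      ∀ w, f w = inner ℂ g (J w) := by
  obtain ⟨s, hs⟩ := J.rangeRestrict.exists_rightInverse_of_surjective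
    (LinearMap.range_eq_top.2 J.surjective_rangeRestrict)
  have hs' : ∀ y : J.range, J (s y) = y := fun y =>
    congrArg Subtype.val (LinearMap.congr_fun hs y)
  obtain ⟨F, hF, -⟩ := exists_extension_norm_eq J.range
    ((f ∘ₗ s).mkContinuous C fun y => by simpa [hs'] using hf (s y))
  set U := J.range.topologicalClosure
  have : CompleteSpace U := J.range.isClosed_topologicalClosure.completeSpace_coe
  set g₀ := (InnerProductSpace.toDual ℂ E).symm F
  have hg : U.starProjection g₀ ∈ closure (J.range : Set E) := by
    rw [← Submodule.topologicalClosure_coe]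
    exact U.starProjection_apply_mem g₀
  obtain ⟨x, hx, hlim⟩ := mem_closure_iff_seq_limit.1 hg
  choose v hv using hx
  refine ⟨_, v, by simpa only [hv] using hlim, fun w => ?_⟩
  have hJw : J w ∈ J.range := LinearMap.mem_range_self J w
  have horth : inner ℂ (g₀ - U.starProjection g₀) (J w) = 0 :=
    Submodule.inner_left_of_mem_orthogonal (J.range.le_topologicalClosure hJw)
      (U.sub_starProjection_mem_orthogonal g₀)
  rw [inner_sub_left, sub_eq_zero] at horth
  rw [← horth, InnerProductSpace.toDual_symm_apply]
  have h1 := hF ⟨J w, hJw⟩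
  simp only [LinearMap.mkContinuous_apply, LinearMap.comp_apply] at h1
  rw [h1]
  have h2 := hf (w - s ⟨J w, hJw⟩)
  rw [map_sub, map_sub, hs', sub_self, norm_zero, mul_zero, norm_le_zero_iff, sub_eq_zero] at h2
  exact h2

theorem exists_tendsto_eval {P : Type*} (J : V →ₗ[ℂ] E) (e : P → V →ₗ[ℂ] ℂ) (c : P → ℝ)
    (he : ∀ p v, ‖e p v‖ ≤ c p * ‖J v‖) {g : E} {v : ℕ → V}
    (hv : Filter.Tendsto (fun n => J (v n)) Filter.atTop (nhds g)) :
    ∃ G : P → ℂ, (∀ p, Filter.Tendsto (fun n => e p (v n)) Filter.atTop (nhds (G p))) ∧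
      (∀ p, ‖G p‖ ≤ c p * ‖g‖) ∧ ∀ p n, ‖G p - e p (v n)‖ ≤ c p * ‖g - J (v n)‖ := by
  have hdiff : ∀ p m n, ‖e p (v m) - e p (v n)‖ ≤ c p * ‖J (v m) - J (v n)‖ := fun p m n => by
    simpa only [map_sub] using he p (v m - v n)
  have hex : ∀ p, ∃ z, Filter.Tendsto (fun n => e p (v n)) Filter.atTop (nhds z) := by
    intro p
    refine cauchySeq_tendsto_of_complete (Metric.cauchySeq_iff'.2 fun ε hε => ?_)
    have hc := hv.cauchySeq
    obtain ⟨N, hN⟩ := Metric.cauchySeq_iff'.1 hc (ε / (|c p| + 1)) (by positivity)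
    refine ⟨N, fun n hn => ?_⟩
    have h1 := hN n hn
    rw [dist_eq_norm, lt_div_iff₀ (by positivity)] at h1
    rw [dist_eq_norm]
    refine (hdiff p n N).trans_lt (lt_of_le_of_lt ?_ h1)
    nlinarith [le_abs_self (c p), norm_nonneg (J (v n) - J (v N))]
  choose G hG using hex
  refine ⟨G, hG, fun p => ?_, fun p n => ?_⟩
  · exact le_of_tendsto_of_tendsto' (hG p).norm (hv.norm.const_mul _) fun n => he p (v n)
  · exact le_of_tendsto_of_tendsto' ((hG p).sub_const _).norm
      ((hv.sub_const _).norm.const_mul _) fun m => hdiff p m n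

end Hilbert

section Weights

theorem IsM2'.exists_shift {M : ℕ → ℝ} (hM : ∀ p, 0 < M p) (h : IsM2' M) (N : ℕ) :
    ∃ B L : ℝ, 1 ≤ B ∧ 1 ≤ L ∧ ∀ k ≤ N, ∀ n, M (n + k) ≤ B * L ^ n * M n := by
  obtain ⟨A, H, hA, hH, hAH⟩ := h
  induction N with
  | zero => exact ⟨1, 1, le_rfl, le_rfl, fun k hk n => by simp [Nat.le_zero.1 hk]⟩
  | succ N ih =>
    obtain ⟨B, L, hB, hL, hBL⟩ := ih
    have h1 : 1 ≤ A * H ^ N := one_le_mul_of_one_le_of_one_le hA (one_le_pow₀ hH)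
    refine ⟨A * H ^ N * B, H * L, one_le_mul_of_one_le_of_one_le h1 hB,
      one_le_mul_of_one_le_of_one_le hH hL, fun k hk n => ?_⟩
    rcases Nat.lt_or_ge N k with hk' | hk'
    · obtain rfl : k = N + 1 := by omega
      calc M (n + (N + 1)) ≤ A * H ^ (n + N) * M (n + N) := hAH (n + N)
        _ ≤ A * H ^ (n + N) * (B * L ^ n * M n) := by
          gcongr
          exact hBL N le_rfl n
        _ = A * H ^ N * B * (H * L) ^ n * M n := by rw [pow_add, mul_pow]; ring
    · refine (hBL k hk' n).trans ?_
      have := (hM n).le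
      gcongr
      · exact le_mul_of_one_le_left (by linarith) h1
      · exact le_mul_of_one_le_left (by linarith) hH

/-- The weight `(1+|x|)^{|α|-q} / (ℓ^{|α|} M_α)` of the norm `‖·‖_{K^{M_p,ℓ}_q}`. -/
def kWeight (M : ℕ → ℝ) (q : ℕ) (ℓ : ℝ) (α : Fin d → ℕ) (x : Rd d) : ℝ :=
  (1 + ‖x‖) ^ mOrd α / (1 + ‖x‖) ^ q / (ℓ ^ mOrd α * M (mOrd α))

variable {M : ℕ → ℝ} {q : ℕ} {ℓ : ℝ}

theorem kWeight_nonneg (hM : ∀ p, 0 < M p) (hℓ : 0 < ℓ) (α : Fin d → ℕ) (x : Rd d) :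
    0 ≤ kWeight M q ℓ α x := by
  have := hM (mOrd α)
  unfold kWeight
  positivity

theorem kWeight_eq (M : ℕ → ℝ) (q : ℕ) (ℓ : ℝ) (α : Fin d → ℕ) (x : Rd d) :
    kWeight M q ℓ α x = (1 + ‖x‖) ^ ((mOrd α : ℤ) - q) / (ℓ ^ mOrd α * M (mOrd α)) := by
  have : (1 + ‖x‖) ≠ 0 := by positivity
  rw [kWeight, zpow_sub₀ this, zpow_natCast, zpow_natCast]

theorem continuous_kWeight (M : ℕ → ℝ) (q : ℕ) (ℓ : ℝ) (α : Fin d → ℕ) :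
    Continuous (kWeight M q ℓ α) := by
  have : ∀ x : Rd d, (1 + ‖x‖) ^ q ≠ 0 := fun x => by positivity
  unfold kWeight
  fun_prop (disch := assumption)

theorem norm_sub_le_of_mem_cube {x y : Rd d} (h : ∀ i, y i ∈ Set.Icc (x i) (x i + 1)) :
    ‖y - x‖ ≤ √d := by
  rw [EuclideanSpace.norm_eq]
  apply Real.sqrt_le_sqrt
  calc ∑ i, ‖(y - x) i‖ ^ 2 ≤ ∑ _i : Fin d, (1 : ℝ) := by
        refine Finset.sum_le_sum fun i _ => ?_
        have := h i
        rw [Set.mem_Icc] at this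
        rw [Real.norm_eq_abs, sq_abs, PiLp.sub_apply]
        nlinarith
    _ = d := by simp

theorem exists_kWeight_le (d : ℕ) (hM : ∀ p, 0 < M p) (hM2' : IsM2' M) (q : ℕ) :
    ∃ D K : ℝ, 1 ≤ D ∧ 1 ≤ K ∧ ∀ ℓ : ℝ, 0 < ℓ → ℓ ≤ 1 →
      ∀ (α : Fin d → ℕ) (t : Finset (Fin d)) (x y : Rd d),
        (∀ i, y i ∈ Set.Icc (x i) (x i + 1)) →
        kWeight M q ℓ α x ≤ D * K ^ mOrd α * kWeight M q ℓ (α + indIdx t) y := by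
  obtain ⟨B, L, hB, hL, hBL⟩ := hM2'.exists_shift hM d
  set b : ℝ := 1 + √d with hb
  have hb1 : 1 ≤ b := by simp [hb]
  refine ⟨b ^ q * B, b * L, one_le_mul_of_one_le_of_one_le (one_le_pow₀ hb1) hB,
    one_le_mul_of_one_le_of_one_le hb1 hL, fun ℓ hℓ hℓ1 α t x y hxy => ?_⟩
  have hd := norm_sub_le_of_mem_cube hxy
  have hx : 1 + ‖x‖ ≤ b * (1 + ‖y‖) := by
    have h2 : ‖x‖ ≤ ‖y‖ + ‖y - x‖ := by simpa using norm_sub_le y (y - x)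
    nlinarith [norm_nonneg y, Real.sqrt_nonneg d]
  have hy : 1 + ‖y‖ ≤ b * (1 + ‖x‖) := by
    have h2 : ‖y‖ ≤ ‖x‖ + ‖y - x‖ := by simpa using norm_add_le x (y - x)
    nlinarith [norm_nonneg x, Real.sqrt_nonneg d]
  have hk := mOrd_indIdx_le t
  unfold kWeight
  rw [mOrd_add]
  set n := mOrd α
  set k := mOrd (indIdx t)
  have hMn := hM n
  have hMk := hM (n + k)
  have h1 : (1 + ‖x‖) ^ n ≤ b ^ n * (1 + ‖y‖) ^ (n + k) := by
    calc (1 + ‖x‖) ^ n ≤ (b * (1 + ‖y‖)) ^ n := by gcongr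
      _ = b ^ n * (1 + ‖y‖) ^ n := mul_pow _ _ _
      _ ≤ b ^ n * (1 + ‖y‖) ^ (n + k) := by
        gcongr
        · linarith [norm_nonneg y]
        · omega
  have h2 : ((1 + ‖x‖) ^ q)⁻¹ ≤ b ^ q * ((1 + ‖y‖) ^ q)⁻¹ := by
    rw [← div_eq_mul_inv, le_div_iff₀ (by positivity), inv_mul_le_iff₀ (by positivity),
      ← mul_pow, mul_comm]
    gcongr
  have h3 : (ℓ ^ n * M n)⁻¹ ≤ B * L ^ n * (ℓ ^ (n + k) * M (n + k))⁻¹ := by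
    rw [← div_eq_mul_inv, le_div_iff₀ (by positivity), inv_mul_le_iff₀ (by positivity)]
    calc ℓ ^ (n + k) * M (n + k) ≤ ℓ ^ n * (B * L ^ n * M n) := by
          have := hBL k hk n
          gcongr ?_ * ?_
          exact pow_le_pow_of_le_one hℓ.le hℓ1 (by omega)
      _ = _ := by ring
  calc (1 + ‖x‖) ^ n / (1 + ‖x‖) ^ q / (ℓ ^ n * M n)
      = (1 + ‖x‖) ^ n * ((1 + ‖x‖) ^ q)⁻¹ * (ℓ ^ n * M n)⁻¹ := by
        rw [div_eq_mul_inv, div_eq_mul_inv]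
    _ ≤ (b ^ n * (1 + ‖y‖) ^ (n + k)) * (b ^ q * ((1 + ‖y‖) ^ q)⁻¹) *
        (B * L ^ n * (ℓ ^ (n + k) * M (n + k))⁻¹) := by gcongr
    _ = _ := by rw [div_eq_mul_inv, div_eq_mul_inv, mul_pow]; ring

end Weights

section Embedding

/-- The test functions of class `(M_p)`, with global instead of local derivative bounds. -/
def testSubmodule (M : ℕ → ℝ) (d : ℕ) : Submodule ℂ (Rd d → ℂ) where
  carrier := {φ | ContDiff ℝ (⊤ : ℕ∞) φ ∧ HasCompactSupport φ ∧ ∀ ℓ > (0 : ℝ), ∃ C : ℝ,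
    ∀ (α : Fin d → ℕ) (x : Rd d), ‖mderiv α φ x‖ ≤ C * (ℓ ^ mOrd α * M (mOrd α))}
  zero_mem' := by
    refine ⟨contDiff_const, HasCompactSupport.zero, fun ℓ _ => ⟨0, fun α x => ?_⟩⟩
    have := mderiv_smul α 0 (f := (0 : Rd d → ℂ)) contDiff_const
    simp only [zero_smul] at this
    simp [this]
  add_mem' := by
    rintro φ ψ ⟨h1, h2, h3⟩ ⟨k1, k2, k3⟩
    refine ⟨h1.add k1, h2.add k2, fun ℓ hℓ => ?_⟩
    obtain ⟨C, hC⟩ := h3 ℓ hℓ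
    obtain ⟨D, hD⟩ := k3 ℓ hℓ
    refine ⟨C + D, fun α x => ?_⟩
    rw [mderiv_add α h1 k1, add_mul]
    exact (norm_add_le _ _).trans (add_le_add (hC α x) (hD α x))
  smul_mem' := by
    rintro c φ ⟨h1, h2, h3⟩
    refine ⟨contDiff_const.smul h1, h2.smul_left (f := fun _ => c), fun ℓ hℓ => ?_⟩
    obtain ⟨C, hC⟩ := h3 ℓ hℓ
    refine ⟨‖c‖ * C, fun α x => ?_⟩
    rw [mderiv_smul α c h1, Pi.smul_apply, norm_smul, mul_assoc]
    gcongr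
    exact hC α x

variable {M : ℕ → ℝ} {q : ℕ} {ℓ : ℝ}

theorem IsTestD.mem_testSubmodule (hM : ∀ p, 0 < M p) {φ : Rd d → ℂ} (hφ : IsTestD M φ) :
    φ ∈ testSubmodule M d := by
  refine ⟨hφ.1, hφ.2.1, fun ℓ hℓ => ?_⟩
  obtain ⟨C, hC⟩ := hφ.2.2 ℓ hℓ
  refine ⟨max C 0, fun α x => ?_⟩
  have hpos : 0 < ℓ ^ mOrd α * M (mOrd α) := mul_pos (pow_pos hℓ _) (hM _)
  by_cases hx : x ∈ tsupport φ
  · rw [← div_le_iff₀ hpos]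
    exact (hC ⟨α, x, hx, rfl⟩).trans (le_max_left _ _)
  · rw [image_eq_zero_of_notMem_tsupport fun h => hx (tsupport_mderiv_subset α φ h), norm_zero]
    positivity

/-- The family of weighted derivatives of `φ`. -/
def wderiv (M : ℕ → ℝ) (q : ℕ) (ℓ : ℝ) (φ : Rd d → ℂ) (p : (Fin d → ℕ) × Rd d) : ℂ :=
  (kWeight M q ℓ p.1 p.2 : ℂ) * mderiv p.1 φ p.2

theorem norm_wderiv (hM : ∀ p, 0 < M p) (hℓ : 0 < ℓ) (φ : Rd d → ℂ) (p : (Fin d → ℕ) × Rd d) :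
    ‖wderiv M q ℓ φ p‖ = kWeight M q ℓ p.1 p.2 * ‖mderiv p.1 φ p.2‖ := by
  rw [wderiv, norm_mul, Complex.norm_real, Real.norm_of_nonneg (kWeight_nonneg hM hℓ _ _)]

theorem continuous_wderiv {φ : Rd d → ℂ} (hφ : ContDiff ℝ (⊤ : ℕ∞) φ) (α : Fin d → ℕ) :
    Continuous fun x => wderiv M q ℓ φ (α, x) :=
  (Complex.continuous_ofReal.comp (continuous_kWeight M q ℓ α)).mul (contDiff_mderiv α hφ).continuous

theorem measurable_wderiv {φ : Rd d → ℂ} (hφ : ContDiff ℝ (⊤ : ℕ∞) φ) :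
    Measurable (wderiv M q ℓ φ) :=
  measurable_from_prod_countable_right fun α => (continuous_wderiv hφ α).measurable

theorem exists_norm_wderiv_le (hM : ∀ p, 0 < M p) (hℓ : 0 < ℓ) {φ : Rd d → ℂ}
    (hφ : φ ∈ testSubmodule M d) {ρ : ℝ} (hρ : 0 < ρ) :
    ∃ C R : ℝ, 0 ≤ C ∧ ∀ (α : Fin d → ℕ) (x : Rd d), ‖wderiv M q ℓ φ (α, x)‖ ≤
      C * ρ ^ mOrd α * (Metric.closedBall (0 : Rd d) R).indicator 1 x := by
  obtain ⟨h1, h2, h3⟩ := hφ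
  obtain ⟨R, hR0, hR⟩ := h2.isCompact.isBounded.subset_closedBall_lt 0 0
  obtain ⟨C, hC⟩ := h3 (ρ * ℓ / (1 + R)) (by positivity)
  refine ⟨max C 0, R, le_max_right _ _, fun α x => ?_⟩
  by_cases hx : x ∈ Metric.closedBall (0 : Rd d) R
  · rw [norm_wderiv hM hℓ, Set.indicator_of_mem hx, Pi.one_apply, mul_one]
    have hxR : ‖x‖ ≤ R := by simpa using hx
    have hMα := hM (mOrd α)
    have hw : kWeight M q ℓ α x ≤ (1 + R) ^ mOrd α / (ℓ ^ mOrd α * M (mOrd α)) := by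
      unfold kWeight
      gcongr
      refine (div_le_self (by positivity) (one_le_pow₀ (by linarith [norm_nonneg x]))).trans ?_
      gcongr
    have hb : ‖mderiv α φ x‖ ≤ max C 0 * ((ρ * ℓ / (1 + R)) ^ mOrd α * M (mOrd α)) :=
      (hC α x).trans (by gcongr; exact le_max_left _ _)
    calc kWeight M q ℓ α x * ‖mderiv α φ x‖
        ≤ (1 + R) ^ mOrd α / (ℓ ^ mOrd α * M (mOrd α)) *
          (max C 0 * ((ρ * ℓ / (1 + R)) ^ mOrd α * M (mOrd α))) := by gcongr
      _ = max C 0 * ρ ^ mOrd α := by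
        rw [div_pow, mul_pow]
        field_simp
  · have : mderiv α φ x = 0 :=
      image_eq_zero_of_notMem_tsupport fun h => hx (hR (tsupport_mderiv_subset α φ h))
    simp [wderiv, this, hx]

theorem memLp_wderiv (hM : ∀ p, 0 < M p) (q : ℕ) (hℓ : 0 < ℓ) {φ : Rd d → ℂ}
    (hφ : φ ∈ testSubmodule M d) :
    MemLp (wderiv M q ℓ φ) 2 (Measure.count.prod volume) := by
  obtain ⟨C, R, hC, h⟩ := exists_norm_wderiv_le (q := q) hM hℓ hφ (ρ := 1 / 2) (by norm_num)
  have hmeas := (measurable_wderiv (M := M) (q := q) (ℓ := ℓ) hφ.1).aestronglyMeasurable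
    (μ := Measure.count.prod volume)
  rw [memLp_two_iff_integrable_sq_norm hmeas]
  have hcount : Integrable (fun α : Fin d → ℕ => C ^ 2 * (1 / 4 : ℝ) ^ mOrd α) Measure.count := by
    rw [integrable_count_iff]
    exact ((summable_pow_mOrd (by norm_num) (by norm_num) d).mul_left _).norm
  have hball : Integrable ((Metric.closedBall (0 : Rd d) R).indicator (1 : Rd d → ℝ)) :=
    (integrable_indicator_iff measurableSet_closedBall).2
      (integrableOn_const (by exact measure_closedBall_lt_top.ne))
  refine (hcount.mul_prod hball).mono' (hmeas.norm.pow 2) (ae_of_all _ ?_)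
  rintro ⟨α, x⟩
  rw [Real.norm_of_nonneg (by positivity)]
  refine (pow_le_pow_left₀ (norm_nonneg _) (h α x) 2).trans_eq ?_
  rw [mul_pow, mul_pow, ← pow_mul, mul_comm (mOrd α), pow_mul]
  by_cases hx : x ∈ Metric.closedBall (0 : Rd d) R
  · norm_num [hx]
  · simp [hx]

/-- Evaluation of the family of weighted derivatives at a point, as a linear functional. -/
def wderivEval (M : ℕ → ℝ) (q : ℕ) (ℓ : ℝ) (p : (Fin d → ℕ) × Rd d) :
    testSubmodule M d →ₗ[ℂ] ℂ where
  toFun φ := wderiv M q ℓ φ p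
  map_add' φ ψ := by
    simp only [wderiv, Submodule.coe_add]
    rw [mderiv_add _ φ.2.1 ψ.2.1, Pi.add_apply, mul_add]
  map_smul' c φ := by
    simp only [wderiv, Submodule.coe_smul, RingHom.id_apply, smul_eq_mul]
    rw [mderiv_smul _ c φ.2.1, Pi.smul_apply, smul_eq_mul, mul_left_comm]

/-- The family of weighted derivatives as an element of `L²`. -/
def wderivLp (hM : ∀ p, 0 < M p) (q : ℕ) (hℓ : 0 < ℓ) :
    testSubmodule M d →ₗ[ℂ] Lp ℂ 2 ((Measure.count : Measure (Fin d → ℕ)).prod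
      (volume : Measure (Rd d))) where
  toFun φ := (memLp_wderiv hM q hℓ φ.2).toLp _
  map_add' φ ψ := by
    rw [← MemLp.toLp_add]
    congr 1
    exact funext fun p => (wderivEval M q ℓ p).map_add φ ψ
  map_smul' c φ := by
    rw [RingHom.id_apply, ← MemLp.toLp_const_smul]
    congr 1
    exact funext fun p => (wderivEval M q ℓ p).map_smul c φ

theorem wderivLp_coe (hM : ∀ p, 0 < M p) (hℓ : 0 < ℓ) (φ : testSubmodule M d) :
    wderivLp hM q hℓ φ =ᵐ[Measure.count.prod volume] wderiv M q ℓ φ :=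
  MemLp.coeFn_toLp (memLp_wderiv hM q hℓ φ.2)

theorem enorm_sq_wderivLp (hM : ∀ p, 0 < M p) (hℓ : 0 < ℓ) (φ : testSubmodule M d) :
    ‖wderivLp hM q hℓ φ‖ₑ ^ 2 = ∑' α : Fin d → ℕ, ∫⁻ x : Rd d, ‖wderiv M q ℓ φ.1 (α, x)‖ₑ ^ 2 := by
  have hm := (measurable_wderiv (M := M) (q := q) (ℓ := ℓ) (φ := φ.1) φ.2.1).enorm.pow_const 2
  have h := eLpNorm_nnreal_pow_eq_lintegral (f := wderiv M q ℓ φ.1)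
    (μ := (Measure.count : Measure (Fin d → ℕ)).prod (volume : Measure (Rd d))) (p := 2) (by simp)
  have h1 : ‖wderivLp hM q hℓ φ‖ₑ = eLpNorm (wderiv M q ℓ φ.1) 2 (Measure.count.prod volume) :=
    Lp.enorm_toLp (memLp_wderiv hM q hℓ φ.2)
  simp only [NNReal.coe_ofNat, ENNReal.coe_ofNat, ENNReal.rpow_ofNat] at h
  rw [h1, h, lintegral_prod _ hm.aemeasurable, lintegral_count]

theorem exists_norm_wderiv_le_norm (d : ℕ) (hM : ∀ p, 0 < M p) (hM2' : IsM2' M) (q : ℕ) :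
    ∃ D K : ℝ, 1 ≤ D ∧ 1 ≤ K ∧ ∀ (ℓ : ℝ) (hℓ : 0 < ℓ), ℓ ≤ 1 →
      ∀ (φ : testSubmodule M d) (p : (Fin d → ℕ) × Rd d),
        ‖wderiv M q ℓ φ p‖ ≤ D * K ^ mOrd p.1 * ‖wderivLp hM q hℓ φ‖ := by
  obtain ⟨D, K, hD, hK, hDK⟩ := exists_kWeight_le d hM hM2' q
  refine ⟨2 ^ d * D, K, one_le_mul_of_one_le_of_one_le (one_le_pow₀ (by norm_num)) hD, hK,
    fun ℓ hℓ hℓ1 φ => ?_⟩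
  rintro ⟨α, x⟩
  have hen : ∀ (α : Fin d → ℕ) (x : Rd d), ‖wderiv M q ℓ φ (α, x)‖ₑ =
      ENNReal.ofReal (kWeight M q ℓ α x) * ‖mderiv α φ x‖ₑ := by
    intro α x
    rw [← ofReal_norm, norm_wderiv hM hℓ, ENNReal.ofReal_mul (kWeight_nonneg hM hℓ _ _),
      ofReal_norm]
  set c := ENNReal.ofReal (D * K ^ mOrd α) with hc
  set S := {y : Rd d | ∀ i, y i ∈ Set.Icc (x i) (x i + 1)} with hS
  have hSm : MeasurableSet S := by
    rw [hS, Set.ofPred_forall]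
    refine MeasurableSet.iInter fun i => ?_
    exact (by fun_prop : Measurable fun y : Rd d => y i) measurableSet_Icc
  have hslice : ∀ t : Finset (Fin d), ENNReal.ofReal (kWeight M q ℓ α x) ^ 2 *
      ∫⁻ y in S, ‖mderiv (α + indIdx t) φ y‖ₑ ^ 2 ≤ c ^ 2 * ‖wderivLp hM q hℓ φ‖ₑ ^ 2 := by
    intro t
    rw [← lintegral_const_mul' _ _ (by simp)]
    calc ∫⁻ y in S, ENNReal.ofReal (kWeight M q ℓ α x) ^ 2 * ‖mderiv (α + indIdx t) φ y‖ₑ ^ 2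
        ≤ ∫⁻ y in S, c ^ 2 * ‖wderiv M q ℓ φ (α + indIdx t, y)‖ₑ ^ 2 := by
          refine setLIntegral_mono' hSm fun y hy => ?_
          rw [hen, ← mul_pow, ← mul_pow, ← mul_assoc, hc, ← ENNReal.ofReal_mul (by positivity)]
          gcongr
          exact hDK ℓ hℓ hℓ1 α t x y hy
      _ ≤ ∫⁻ y, c ^ 2 * ‖wderiv M q ℓ φ (α + indIdx t, y)‖ₑ ^ 2 := setLIntegral_le_lintegral _ _
      _ = c ^ 2 * ∫⁻ y, ‖wderiv M q ℓ φ (α + indIdx t, y)‖ₑ ^ 2 :=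
          lintegral_const_mul' _ _ (by simp [hc])
      _ ≤ _ := by
          rw [enorm_sq_wderivLp]
          gcongr
          exact ENNReal.le_tsum (f := fun β : Fin d → ℕ => ∫⁻ y : Rd d, ‖wderiv M q ℓ φ.1 (β, y)‖ₑ ^ 2) _
  have hsq : ‖wderiv M q ℓ φ (α, x)‖ₑ ^ 2 ≤ (2 ^ d * c * ‖wderivLp hM q hℓ φ‖ₑ) ^ 2 := by
    calc ‖wderiv M q ℓ φ (α, x)‖ₑ ^ 2
        = ENNReal.ofReal (kWeight M q ℓ α x) ^ 2 * ‖mderiv α φ x‖ₑ ^ 2 := by rw [hen, mul_pow]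
      _ ≤ ENNReal.ofReal (kWeight M q ℓ α x) ^ 2 * (2 ^ d * ∑ t : Finset (Fin d),
          ∫⁻ y in S, ‖mderiv (α + indIdx t) φ y‖ₑ ^ 2) := by
          gcongr
          exact enorm_sq_mderiv_le_lintegral φ.2.1 x α
      _ = 2 ^ d * ∑ t : Finset (Fin d), ENNReal.ofReal (kWeight M q ℓ α x) ^ 2 *
          ∫⁻ y in S, ‖mderiv (α + indIdx t) φ y‖ₑ ^ 2 := by rw [mul_left_comm, Finset.mul_sum]
      _ ≤ 2 ^ d * ∑ _t : Finset (Fin d), c ^ 2 * ‖wderivLp hM q hℓ φ‖ₑ ^ 2 :=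
          mul_le_mul' le_rfl (Finset.sum_le_sum fun t _ => hslice t)
      _ = _ := by
          simp only [Finset.sum_const, Finset.card_univ, Fintype.card_finset, Fintype.card_fin,
            nsmul_eq_mul]
          push_cast
          ring
  have hle : ‖wderiv M q ℓ φ (α, x)‖ₑ ≤ 2 ^ d * c * ‖wderivLp hM q hℓ φ‖ₑ :=
    (ENNReal.pow_le_pow_left_iff two_ne_zero).1 hsq
  have h2 : (2 : ENNReal) ^ d = ENNReal.ofReal (2 ^ d) := by
    rw [ENNReal.ofReal_pow (by norm_num)]; simp
  rw [← ofReal_norm, ← ofReal_norm, hc, h2, ← ENNReal.ofReal_mul (by positivity),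
    ← ENNReal.ofReal_mul (by positivity), ENNReal.ofReal_le_ofReal_iff (by positivity)] at hle
  simpa only [mul_assoc] using hle

end Embedding

section Duality

theorem norm_le_of_isKDual_bound {M : ℕ → ℝ} (hM : ∀ p, 0 < M p) {q : ℕ}
    {f : (Rd d → ℂ) →ₗ[ℂ] ℂ} {ℓ₀ C₀ : ℝ}
    (hfb : ∀ φ : Rd d → ℂ, ContDiff ℝ (⊤ : ℕ∞) φ → (∀ ℓ' > (0 : ℝ), KnormFin M q ℓ' φ) →
      ‖f φ‖ ≤ C₀ * Knorm M q ℓ₀ φ) (hC₀ : 0 ≤ C₀) (hℓ₀ : 0 < ℓ₀) {ℓ D K : ℝ} (hℓ : 0 < ℓ)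
    (hDK : 0 ≤ D ∧ 0 ≤ K) (hKℓ : K * ℓ ≤ ℓ₀)
    (hbound : ∀ (φ : testSubmodule M d) (p : (Fin d → ℕ) × Rd d),
      ‖wderiv M q ℓ φ p‖ ≤ D * K ^ mOrd p.1 * ‖wderivLp hM q hℓ φ‖) (φ : testSubmodule M d) :
    ‖f φ‖ ≤ C₀ * D * ‖wderivLp hM q hℓ φ‖ := by
  obtain ⟨hD, hK⟩ := hDK
  refine (hfb φ φ.2.1 fun ℓ' hℓ' => ?_).trans ?_
  · obtain ⟨C, R, hC, h⟩ := exists_norm_wderiv_le (q := q) hM hℓ' φ.2 one_pos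
    refine ⟨C, ?_⟩
    rintro r ⟨α, x, rfl⟩
    rw [mul_div_right_comm, ← kWeight_eq, ← norm_wderiv hM hℓ' φ.1 (α, x)]
    refine (h α x).trans ?_
    rw [one_pow, mul_one]
    refine mul_le_of_le_one_right hC (Set.indicator_le_self' (fun _ _ => zero_le_one) x)
  · rw [mul_assoc]
    refine mul_le_mul_of_nonneg_left (csSup_le ⟨_, 0, 0, rfl⟩ ?_) hC₀
    rintro r ⟨α, x, rfl⟩
    have hMα := hM (mOrd α)
    have h := hbound φ (α, x)
    rw [norm_wderiv hM hℓ, kWeight_eq] at h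
    simp only at h
    rw [mul_div_right_comm]
    calc (1 + ‖x‖) ^ ((mOrd α : ℤ) - q) / (ℓ₀ ^ mOrd α * M (mOrd α)) * ‖mderiv α φ x‖
        = (1 + ‖x‖) ^ ((mOrd α : ℤ) - q) / (ℓ ^ mOrd α * M (mOrd α)) * ‖mderiv α φ x‖ *
          (ℓ / ℓ₀) ^ mOrd α := by
          rw [div_pow]
          field_simp
      _ ≤ D * K ^ mOrd α * ‖wderivLp hM q hℓ φ‖ * (ℓ / ℓ₀) ^ mOrd α := by gcongr
      _ = (K * ℓ / ℓ₀) ^ mOrd α * (D * ‖wderivLp hM q hℓ φ‖) := by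
          rw [div_pow, div_pow, mul_pow]
          ring
      _ ≤ D * ‖wderivLp hM q hℓ φ‖ :=
          mul_le_of_le_one_left (by positivity)
            (pow_le_one₀ (by positivity) ((div_le_one hℓ₀).2 hKℓ))

end Duality

/-- first structure theorem for elements of `K'^{(M_p)}(ℝ^d)`. -/
theorem stmt15 {d : ℕ} (M : ℕ → ℝ) (hM1 : IsM1 M) (hM2' : IsM2' M) (hM3' : IsM3' M)
    (f : (Rd d → ℂ) →ₗ[ℂ] ℂ) (hf : IsKDual M f) :
    ∀ q : ℕ, ∃ F : (Fin d → ℕ) → Rd d → ℂ, (∀ α, Continuous (F α)) ∧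
      ∃ ℓ > (0 : ℝ), ∃ C > (0 : ℝ),
        (∀ (α : Fin d → ℕ) (x : Rd d),
          ‖F α x‖ ≤ C * (ℓ ^ mOrd α / M (mOrd α)) * (1 + ‖x‖) ^ ((mOrd α : ℤ) - q)) ∧
        ∀ φ : Rd d → ℂ, IsTestD M φ →
          (∀ α : Fin d → ℕ, Integrable fun x => F α x * mderiv α φ x) ∧
          Summable (fun α : Fin d → ℕ => ‖∫ x, F α x * mderiv α φ x‖) ∧
          f φ = ∑' α : Fin d → ℕ, (-1 : ℂ) ^ mOrd α * ∫ x, F α x * mderiv α φ x := by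
  intro q
  have hM := hM1.1
  obtain ⟨ℓ₀, hℓ₀, C₀, hC₀, hfb⟩ := hf q
  obtain ⟨D, K, hD, hK, hDK⟩ := exists_norm_wderiv_le_norm d hM hM2' q
  set ℓ : ℝ := min (ℓ₀ / K) 1 with hℓdef
  have hℓ : 0 < ℓ := lt_min (by positivity) one_pos
  have hKℓ : K * ℓ ≤ ℓ₀ := by
    rw [mul_comm, ← le_div_iff₀ (by positivity)]
    exact min_le_left _ _
  have hbound := hDK ℓ hℓ (min_le_right _ _)
  set J := wderivLp (d := d) hM q hℓ with hJ
  have hfJ : ∀ φ : testSubmodule M d, ‖f φ‖ ≤ C₀ * D * ‖J φ‖ :=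
    norm_le_of_isKDual_bound hM hfb hC₀.le hℓ₀ hℓ ⟨by positivity, by positivity⟩ hKℓ hbound
  obtain ⟨g, v, hv, hg⟩ := exists_tendsto_inner_eq J (f ∘ₗ (testSubmodule M d).subtype) hfJ
  obtain ⟨G, hGlim, hGle, hGdiff⟩ := exists_tendsto_eval J (wderivEval M q ℓ)
    (fun p => D * K ^ mOrd p.1) (fun p φ => hbound φ p) hv
  have hGcont : ∀ α, Continuous fun x => G (α, x) := by
    intro α
    have hu : TendstoUniformly (fun n x => wderivEval M q ℓ (α, x) (v n)) (fun x => G (α, x))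
        Filter.atTop := by
      rw [Metric.tendstoUniformly_iff]
      intro ε hε
      have h0 : Filter.Tendsto (fun n => D * K ^ mOrd α * ‖g - J (v n)‖) Filter.atTop (nhds 0) := by
        simpa using (hv.const_sub g).norm.const_mul (D * K ^ mOrd α)
      filter_upwards [h0.eventually_lt_const hε] with n hn x
      rw [dist_eq_norm]
      exact (hGdiff (α, x) n).trans_lt hn
    exact hu.continuous (Filter.Frequently.of_forall fun n => continuous_wderiv (v n).2.1 α)
  have hgG : g =ᵐ[Measure.count.prod volume] G := by
    obtain ⟨ns, hns, hlim⟩ := (tendstoInMeasure_of_tendsto_Lp hv).exists_seq_tendsto_ae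
    filter_upwards [hlim, ae_all_iff.2 fun n => wderivLp_coe (q := q) hM hℓ (v n)] with p hp hp'
    refine tendsto_nhds_unique hp (((hGlim p).comp hns.tendsto_atTop).congr fun n => ?_)
    exact (hp' (ns n)).symm
  refine ⟨fun α x => (-1) ^ mOrd α * (kWeight M q ℓ α x * (starRingEnd ℂ) (G (α, x))),
    fun α => ?_, K / ℓ, by positivity, D * ‖g‖ + 1, by positivity, fun α x => ?_, fun φ hφ => ?_⟩
  · exact continuous_const.mul ((Complex.continuous_ofReal.comp (continuous_kWeight M q ℓ α)).mul
      (Complex.continuous_conj.comp (hGcont α)))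
  · have hMα := hM (mOrd α)
    rw [norm_mul, norm_pow, norm_neg, norm_one, one_pow, one_mul, norm_mul, RCLike.norm_conj,
      Complex.norm_real, Real.norm_of_nonneg (kWeight_nonneg hM hℓ _ _), kWeight_eq]
    calc (1 + ‖x‖) ^ ((mOrd α : ℤ) - q) / (ℓ ^ mOrd α * M (mOrd α)) * ‖G (α, x)‖
        ≤ (1 + ‖x‖) ^ ((mOrd α : ℤ) - q) / (ℓ ^ mOrd α * M (mOrd α)) *
          (D * K ^ mOrd α * ‖g‖) := by
          gcongr
          exact hGle (α, x)
      _ = D * ‖g‖ * ((K / ℓ) ^ mOrd α / M (mOrd α)) * (1 + ‖x‖) ^ ((mOrd α : ℤ) - q) := by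
          rw [div_pow]
          field_simp
      _ ≤ _ := by
          gcongr
          linarith
  · set φ' : testSubmodule M d := ⟨φ, hφ.mem_testSubmodule hM⟩
    have hint : Integrable (fun p => (starRingEnd ℂ) (G p) * wderiv M q ℓ φ p)
        ((Measure.count : Measure (Fin d → ℕ)).prod (volume : Measure (Rd d))) ∧
        f φ = ∫ p, (starRingEnd ℂ) (G p) * wderiv M q ℓ φ p
          ∂((Measure.count : Measure (Fin d → ℕ)).prod (volume : Measure (Rd d))) := by
      have hae : (fun p => inner ℂ (g p) (J φ' p)) =ᵐ[Measure.count.prod volume]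
          fun p => (starRingEnd ℂ) (G p) * wderiv M q ℓ φ p := by
        filter_upwards [hgG, wderivLp_coe (q := q) hM hℓ φ'] with p h1 h2
        rw [h1, h2, RCLike.inner_apply, mul_comm]
      exact ⟨(L2.integrable_inner g (J φ')).congr hae,
        (hg φ').trans ((L2.inner_def g (J φ')).trans (integral_congr_ae hae))⟩
    have hfun : ∀ α x, (-1 : ℂ) ^ mOrd α * (kWeight M q ℓ α x * (starRingEnd ℂ) (G (α, x))) *
        mderiv α φ x = (-1) ^ mOrd α * ((starRingEnd ℂ) (G (α, x)) * wderiv M q ℓ φ (α, x)) := by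
      intro α x
      rw [wderiv]
      ring
    have hslice := Measure.ae_count_iff.1 hint.1.prod_right_ae
    have hsum := hint.1.integral_prod_left
    simp only [hfun]
    refine ⟨fun α => (hslice α).const_mul _, ?_, ?_⟩
    · simpa only [integral_const_mul, norm_mul, norm_pow, norm_neg, norm_one, one_pow, one_mul]
        using integrable_count_iff.1 hsum
    · rw [hint.2, integral_prod _ hint.1, integral_countable hsum]
      refine tsum_congr fun α => ?_
      rw [integral_const_mul, ← mul_assoc, ← mul_pow]
      simp
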